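/- In the asymptotically Schwarzschild coordinates, let m̃_{ab}=m_{αβ}A^α_aA^β_b and m̃^{ab}=A^a_αA^b_βm^{αβ} (the Minkowski metric and its inverse written in the new coordinates), and let Γ̂^c_{ab}=½m̃^{cd}(∂̃_am̃_{bd}+∂̃_bm̃_{ad}−∂̃_dm̃_{ab}) be the Christoffel symbols of m̃. Then for every multiindex I there are constants C_I, independent of M, t, x̃, such that for 0<M≤M₀, all t≥0 and x≠0, and all components: |ℒ_{X̃}^I Γ̂| ≤ C_I M (ln(1+r)+1)(1+r+t)^{−2}, and |ℒ_{X̃}^I (m̃^{ab} − m̂^{ab})| ≤ C_I M (ln(1+r)+1)(1+r+t)^{−1}, where m̂^{ab}=diag(−1,1,1,1) and ℒ_{X̃}^I is a composition of |I| Lie derivatives (of Γ̂ as a (1,2)-tensor and of m̃^{−1} as a (2,0)-tensor) along the modified vector fields. -/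

import Mathlib

noncomputable section
open MeasureTheory

abbrev E3 : Type := EuclideanSpace ℝ (Fin 3)
abbrev Spt : Type := ℝ × E3

/-- The coordinate basis directions of `ℝ^{1+3}`. -/
def dir (a : Fin 4) : Spt :=
  Fin.cases ((1:ℝ), (0:E3)) (fun i => ((0:ℝ), EuclideanSpace.single i (1:ℝ))) a

/-- Coordinate partial derivative `∂_a`. -/
def pd (a : Fin 4) (f : Spt → ℝ) (p : Spt) : ℝ := fderiv ℝ f p (dir a)

def toVec (c : Fin 4 → ℝ) : Spt := ∑ a : Fin 4, c a • dir a

/-- The japanese bracket `⟨s⟩ = 1 + |s|`. -/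
def jap (s : ℝ) : ℝ := 1 + |s|

/-- ω = x/|x| -/
def omg (p : Spt) : E3 := ‖p.2‖⁻¹ • p.2

def Ldir (p : Spt) : Spt := ((1:ℝ), omg p)
def Lbardir (p : Spt) : Spt := ((1:ℝ), -omg p)
def qdir (p : Spt) : Spt := (-(1:ℝ)/2, (2⁻¹:ℝ) • omg p)
def angDir (i : Fin 3) (p : Spt) : Spt :=
  ((0:ℝ), EuclideanSpace.single i (1:ℝ) - omg p i • omg p)

/-- The Minkowski metric (= its inverse) `diag(-1,1,1,1)`. -/
def eta (a b : Fin 4) : ℝ := if a = b then (if a = 0 then -1 else 1) else 0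

def Llow (p : Spt) (a : Fin 4) : ℝ := Fin.cases (-1:ℝ) (fun i => omg p i) a
def Lup (p : Spt) (a : Fin 4) : ℝ := Fin.cases (1:ℝ) (fun i => omg p i) a
def Lbarlow (p : Spt) (a : Fin 4) : ℝ := Fin.cases (-1:ℝ) (fun i => -omg p i) a
def Lbarup (p : Spt) (a : Fin 4) : ℝ := Fin.cases (1:ℝ) (fun i => -omg p i) a

/-- Index type for the Minkowski commuting vector fields: translations,
rotations/boosts, scaling. -/
abbrev ZIdx : Type := Fin 4 ⊕ (Fin 4 × Fin 4) ⊕ Unit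

def xlow (p : Spt) (a : Fin 4) : ℝ := Fin.cases (-p.1) (fun i => p.2 i) a
def xup (p : Spt) (a : Fin 4) : ℝ := Fin.cases p.1 (fun i => p.2 i) a

/-- The components of the Minkowski commuting vector fields. -/
def zfield : ZIdx → Spt → Fin 4 → ℝ
  | Sum.inl a => fun _ c => if c = a then 1 else 0
  | Sum.inr (Sum.inl ab) => fun p c =>
      xlow p ab.1 * (if c = ab.2 then 1 else 0) - xlow p ab.2 * (if c = ab.1 then 1 else 0)
  | Sum.inr (Sum.inr _) => fun p => xup p

/-- `Z^I` applied to a scalar function. -/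
def zApply : {k : ℕ} → (Fin k → ZIdx) → (Spt → ℝ) → Spt → ℝ
  | 0, _, f => f
  | _+1, I, f => fun p => fderiv ℝ (zApply (fun j => I j.succ) f) p (toVec (zfield (I 0) p))

/-- `∂^β` applied to a scalar function. -/
def pdT : {k : ℕ} → (Fin k → Fin 4) → (Spt → ℝ) → Spt → ℝ
  | 0, _, f => f
  | _+1, β, f => pd (β 0) (pdT (fun j => β j.succ) f)

def pdd (a b : Fin 4) (f : Spt → ℝ) : Spt → ℝ := pd a (pd b f)

/-- The flat wave operator `□ = -∂_t² + Δ`. -/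
def box (f : Spt → ℝ) (p : Spt) : ℝ := -(pdd 0 0 f p) + ∑ i : Fin 3, pdd i.succ i.succ f p


/-- Kronecker delta. -/
def kron (a b : Fin 4) : ℝ := if a = b then 1 else 0

/-- The asymptotically Schwarzschild coordinates `x̃⁰ = t`,
`x̃^i = x^i + M ω^i χ(r/(t+1)) ln r`. -/
def xt (M : ℝ) (χ : ℝ → ℝ) (a : Fin 4) : Spt → ℝ :=
  Fin.cases (fun p : Spt => p.1)
    (fun i => fun p : Spt =>
      p.2 i + M * (p.2 i / ‖p.2‖) * χ (‖p.2‖ / (p.1 + 1)) * Real.log ‖p.2‖) a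

/-- The Jacobian `A^a_α = ∂x̃^a/∂x^α`. -/
def Amat (M : ℝ) (χ : ℝ → ℝ) (p : Spt) : Matrix (Fin 4) (Fin 4) ℝ :=
  Matrix.of fun a α => pd α (xt M χ a) p

/-- The inverse Jacobian `A^α_a`. -/
def Ainv (M : ℝ) (χ : ℝ → ℝ) (p : Spt) : Matrix (Fin 4) (Fin 4) ℝ := (Amat M χ p)⁻¹

/-- The tilde coordinate functions as a vector. -/
def xtilde (M : ℝ) (χ : ℝ → ℝ) (p : Spt) (a : Fin 4) : ℝ := xt M χ a p

/-- `x̃_a` (indices lowered with the Minkowski metric). -/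
def xtlow (M : ℝ) (χ : ℝ → ℝ) (p : Spt) (a : Fin 4) : ℝ :=
  Fin.cases (-p.1) (fun i => xtilde M χ p i.succ) a

/-- The tangent vector of the tilde partial `∂̃_a = A^α_a ∂_α`. -/
def tdirVec (M : ℝ) (χ : ℝ → ℝ) (a : Fin 4) (p : Spt) : Spt :=
  toVec (fun α => Ainv M χ p α a)

/-- The tilde partial derivative `∂̃_a f`. -/
def tpd (M : ℝ) (χ : ℝ → ℝ) (a : Fin 4) (f : Spt → ℝ) (p : Spt) : ℝ :=
  fderiv ℝ f p (tdirVec M χ a p)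

/-- The modified vector fields `∂̃_a`, `Ω̃_{ab} = x̃_a∂̃_b - x̃_b∂̃_a`, `S̃ = x̃^a∂̃_a`
(as tangent-vector-valued maps). -/
def mfield (M : ℝ) (χ : ℝ → ℝ) : ZIdx → Spt → Spt
  | Sum.inl a => tdirVec M χ a
  | Sum.inr (Sum.inl ab) => fun p =>
      xtlow M χ p ab.1 • tdirVec M χ ab.2 p - xtlow M χ p ab.2 • tdirVec M χ ab.1 p
  | Sum.inr (Sum.inr _) => fun p => ∑ a : Fin 4, xtilde M χ p a • tdirVec M χ a p

/-- `X̃^I` applied to a scalar function. -/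
def xApply (M : ℝ) (χ : ℝ → ℝ) : {k : ℕ} → (Fin k → ZIdx) → (Spt → ℝ) → Spt → ℝ
  | 0, _, f => f
  | _+1, I, f => fun p => fderiv ℝ (xApply M χ (fun j => I j.succ) f) p (mfield M χ (I 0) p)

/-- `r* = r + M χ(r/(t+1)) ln r`. -/
def rstar (M : ℝ) (χ : ℝ → ℝ) (p : Spt) : ℝ :=
  ‖p.2‖ + M * χ (‖p.2‖ / (p.1 + 1)) * Real.log ‖p.2‖

/-- The tilde components of the modified vector fields. -/
def Xcomp (M : ℝ) (χ : ℝ → ℝ) : ZIdx → Spt → Fin 4 → ℝ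
  | Sum.inl a => fun _ c => kron c a
  | Sum.inr (Sum.inl ab) => fun p c =>
      xtlow M χ p ab.1 * kron c ab.2 - xtlow M χ p ab.2 * kron c ab.1
  | Sum.inr (Sum.inr _) => fun p c => xtilde M χ p c

/-- The Lie derivative of a (2,0)-tensor along a modified vector field, computed in the
tilde coordinates. -/
def lieUp (M : ℝ) (χ : ℝ → ℝ) (X : ZIdx) (K : Spt → Fin 4 → Fin 4 → ℝ) :
    Spt → Fin 4 → Fin 4 → ℝ := fun p a b =>
  (∑ c : Fin 4, Xcomp M χ X p c * tpd M χ c (fun q => K q a b) p)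
  - (∑ c : Fin 4, tpd M χ c (fun q => Xcomp M χ X q a) p * K p c b)
  - (∑ c : Fin 4, tpd M χ c (fun q => Xcomp M χ X q b) p * K p a c)

/-- The Lie derivative of a (1,2)-tensor along a modified vector field. -/
def lie12 (M : ℝ) (χ : ℝ → ℝ) (X : ZIdx) (K : Spt → Fin 4 → Fin 4 → Fin 4 → ℝ) :
    Spt → Fin 4 → Fin 4 → Fin 4 → ℝ := fun p c a b =>
  (∑ e : Fin 4, Xcomp M χ X p e * tpd M χ e (fun q => K q c a b) p)
  - (∑ e : Fin 4, tpd M χ e (fun q => Xcomp M χ X q c) p * K p e a b)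
  + (∑ e : Fin 4, tpd M χ a (fun q => Xcomp M χ X q e) p * K p c e b)
  + (∑ e : Fin 4, tpd M χ b (fun q => Xcomp M χ X q e) p * K p c a e)

/-- Iterated Lie derivatives `ℒ_{X̃}^I` of (2,0)-tensors. -/
def lieUpT (M : ℝ) (χ : ℝ → ℝ) :
    {k : ℕ} → (Fin k → ZIdx) → (Spt → Fin 4 → Fin 4 → ℝ) → Spt → Fin 4 → Fin 4 → ℝ
  | 0, _, K => K
  | _+1, I, K => lieUp M χ (I 0) (lieUpT M χ (fun j => I j.succ) K)

/-- Iterated Lie derivatives `ℒ_{X̃}^I` of (1,2)-tensors. -/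
def lie12T (M : ℝ) (χ : ℝ → ℝ) :
    {k : ℕ} → (Fin k → ZIdx) → (Spt → Fin 4 → Fin 4 → Fin 4 → ℝ) →
      Spt → Fin 4 → Fin 4 → Fin 4 → ℝ
  | 0, _, K => K
  | _+1, I, K => lie12 M χ (I 0) (lie12T M χ (fun j => I j.succ) K)

/-- `m̃_{ab} = m_{αβ} A^α_a A^β_b`. -/
def mtLow (M : ℝ) (χ : ℝ → ℝ) (p : Spt) (a b : Fin 4) : ℝ :=
  ∑ α : Fin 4, ∑ β : Fin 4, eta α β * Ainv M χ p α a * Ainv M χ p β b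

/-- `m̃^{ab} = A^a_α A^b_β m^{αβ}`. -/
def mtUp (M : ℝ) (χ : ℝ → ℝ) (p : Spt) (a b : Fin 4) : ℝ :=
  ∑ α : Fin 4, ∑ β : Fin 4, Amat M χ p a α * Amat M χ p b β * eta α β

/-- The Christoffel symbols `Γ̂^c_{ab}` of `m̃` in the tilde coordinates. -/
def Gammahat (M : ℝ) (χ : ℝ → ℝ) (p : Spt) (c a b : Fin 4) : ℝ :=
  (1/2) * ∑ d : Fin 4, mtUp M χ p c d *
    (tpd M χ a (fun q => mtLow M χ q b d) p + tpd M χ b (fun q => mtLow M χ q a d) p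
      - tpd M χ d (fun q => mtLow M χ q a b) p)

def rho (p : Spt) : ℝ := 1 + ‖p.2‖ + p.1

def Bd (m : ℝ) (V : Set Spt) (w f : ℝ → Spt → ℝ) : Prop :=
  ∃ C : ℝ, 0 ≤ C ∧ ∀ M, 0 < M → M ≤ m → ∀ p ∈ V, |f M p| ≤ C * w M p

def SymN (m : ℝ) (V : Set Spt) : ℕ → (ℝ → Spt → ℝ) → (ℝ → Spt → ℝ) → Prop
  | 0, w, f => Bd m V w f
  | n+1, w, f => Bd m V w f ∧
      (∀ M, 0 < M → M ≤ m → ∀ p ∈ V, DifferentiableAt ℝ (f M) p) ∧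
      ∀ a, SymN m V n (fun M p => w M p / rho p) (fun M => pd a (f M))

lemma SymN.bd {m V n w f} (h : SymN m V n w f) : Bd m V w f := by
  cases n with
  | zero => exact h
  | succ n => exact h.1

lemma SymN.down {m V n w f} (h : SymN m V (n+1) w f) : SymN m V n w f := by
  induction n generalizing w f with
  | zero => exact h.1
  | succ n ih => exact ⟨h.1, h.2.1, fun a => ih (h.2.2 a)⟩

lemma SymN.restrict {m m' V V' n w f} (hm : m' ≤ m) (hV : V' ⊆ V) (h : SymN m V n w f) :
    SymN m' V' n w f := by
  have key : ∀ w f, Bd m V w f → Bd m' V' w f := by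
    rintro w f ⟨C, hC, h⟩
    exact ⟨C, hC, fun M h0 h1 p hp => h M h0 (h1.trans hm) p (hV hp)⟩
  induction n generalizing w f with
  | zero => exact key _ _ h
  | succ n ih =>
    exact ⟨key _ _ h.1, fun M h0 h1 p hp => h.2.1 M h0 (h1.trans hm) p (hV hp),
      fun a => ih (h.2.2 a)⟩

structure Good (V : Set Spt) : Prop where
  op : IsOpen V
  pos : ∀ p ∈ V, 0 < rho p

lemma pd_congr {V : Set Spt} (hV : Good V) {f g : Spt → ℝ} (h : ∀ p ∈ V, f p = g p) {p : Spt}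
    (hp : p ∈ V) (a : Fin 4) : pd a f p = pd a g p := by
  have : f =ᶠ[nhds p] g := by
    filter_upwards [hV.op.mem_nhds hp] with q hq using h q hq
  unfold pd
  rw [this.fderiv_eq]

lemma SymN.congr {m V n w f g} (hV : Good V) (h : SymN m V n w f)
    (hfg : ∀ M, 0 < M → M ≤ m → ∀ p ∈ V, g M p = f M p) : SymN m V n w g := by
  have key : ∀ w f g, (∀ M, 0 < M → M ≤ m → ∀ p ∈ V, g M p = f M p) →
      Bd m V w f → Bd m V w g := by
    rintro w f g hfg ⟨C, hC, h⟩
    exact ⟨C, hC, fun M h0 h1 p hp => by rw [hfg M h0 h1 p hp]; exact h M h0 h1 p hp⟩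
  induction n generalizing w f g with
  | zero => exact key _ _ _ hfg h
  | succ n ih =>
    refine ⟨key _ _ _ hfg h.1, fun M h0 h1 p hp => ?_, fun a => ih (h.2.2 a) ?_⟩
    · have : g M =ᶠ[nhds p] f M := by
        filter_upwards [hV.op.mem_nhds hp] with q hq using hfg M h0 h1 q hq
      exact this.differentiableAt_iff.2 (h.2.1 M h0 h1 p hp)
    · intro M h0 h1 p hp
      exact pd_congr hV (hfg M h0 h1) hp a

lemma SymN.mono {m V n w w' f} (hV : Good V) (h : SymN m V n w f) (K : ℝ) (hK : 0 ≤ K)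
    (hw : ∀ M, 0 < M → M ≤ m → ∀ p ∈ V, w M p ≤ K * w' M p) : SymN m V n w' f := by
  have key : ∀ w w' f, (∀ M, 0 < M → M ≤ m → ∀ p ∈ V, w M p ≤ K * w' M p) →
      Bd m V w f → Bd m V w' f := by
    rintro w w' f hw ⟨C, hC, h⟩
    refine ⟨C * K, by positivity, fun M h0 h1 p hp => (h M h0 h1 p hp).trans ?_⟩
    rw [mul_assoc]
    exact mul_le_mul_of_nonneg_left (hw M h0 h1 p hp) hC
  induction n generalizing w w' f with
  | zero => exact key _ _ _ hw h
  | succ n ih =>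
    refine ⟨key _ _ _ hw h.1, h.2.1, fun a => ih (h.2.2 a) ?_⟩
    intro M h0 h1 p hp
    have := hV.pos p hp
    rw [← mul_div_assoc]
    exact div_le_div_of_nonneg_right (hw M h0 h1 p hp) this.le

lemma SymN.weq {m V n w w' f} (hV : Good V) (h : SymN m V n w f)
    (hw : ∀ M, 0 < M → M ≤ m → ∀ p ∈ V, w M p = w' M p) : SymN m V n w' f :=
  h.mono hV 1 zero_le_one fun M h0 h1 p hp => by rw [one_mul, hw M h0 h1 p hp]

lemma SymN.zero {m V n w} : SymN m V n w (fun _ _ => 0) := by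
  have key : ∀ w, Bd m V w (fun _ _ => 0) := fun w => ⟨0, le_rfl, by simp⟩
  induction n generalizing w with
  | zero => exact key _
  | succ n ih =>
    refine ⟨key _, fun _ _ _ _ _ => by simp, fun a => ?_⟩
    have : (fun M : ℝ => pd a (fun _ : Spt => (0:ℝ))) = fun _ _ => 0 := by
      funext M p; simp [pd]
    rw [this]; exact ih

lemma SymN.constM {m V n} {w : ℝ → Spt → ℝ} (c : ℝ → ℝ) (h : Bd m V w (fun M _ => c M)) :
    SymN m V n w (fun M _ => c M) := by
  cases n with
  | zero => exact h
  | succ n =>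
    refine ⟨h, fun _ _ _ _ _ => by simp, fun a => ?_⟩
    have : (fun M : ℝ => pd a (fun _ : Spt => c M)) = fun _ _ => 0 := by
      funext M p; simp [pd]
    rw [this]; exact SymN.zero

lemma SymN.const {m V n} (c : ℝ) : SymN m V n (fun _ _ => 1) (fun _ _ => c) :=
  SymN.constM (fun _ => c) ⟨|c|, abs_nonneg _, by simp⟩

lemma SymN.add {m V n w f g} (hV : Good V) (hf : SymN m V n w f) (hg : SymN m V n w g) :
    SymN m V n w (fun M p => f M p + g M p) := by
  have key : ∀ w f g, Bd m V w f → Bd m V w g → Bd m V w (fun M p => f M p + g M p) := by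
    rintro w f g ⟨C, hC, h⟩ ⟨D, hD, k⟩
    refine ⟨C + D, by positivity, fun M h0 h1 p hp => ?_⟩
    have := h M h0 h1 p hp
    have := k M h0 h1 p hp
    have := abs_add_le (f M p) (g M p)
    simp only; linarith
  induction n generalizing w f g with
  | zero => exact key _ _ _ hf hg
  | succ n ih =>
    refine ⟨key _ _ _ hf.1 hg.1, fun M h0 h1 p hp =>
      (hf.2.1 M h0 h1 p hp).add (hg.2.1 M h0 h1 p hp), fun a => ?_⟩
    refine (ih (hf.2.2 a) (hg.2.2 a)).congr hV fun M h0 h1 p hp => ?_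
    simp only [pd]
    rw [fderiv_fun_add (hf.2.1 M h0 h1 p hp) (hg.2.1 M h0 h1 p hp)]; rfl

lemma SymN.mul {m V n w w' f g} (hV : Good V) (hf : SymN m V n w f) (hg : SymN m V n w' g) :
    SymN m V n (fun M p => w M p * w' M p) (fun M p => f M p * g M p) := by
  have key : ∀ w w' f g, Bd m V w f → Bd m V w' g →
      Bd m V (fun M p => w M p * w' M p) (fun M p => f M p * g M p) := by
    rintro w w' f g ⟨C, hC, h⟩ ⟨D, hD, k⟩
    refine ⟨C * D, by positivity, fun M h0 h1 p hp => ?_⟩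
    have h1' := h M h0 h1 p hp
    have := mul_le_mul h1' (k M h0 h1 p hp) (abs_nonneg _) ((abs_nonneg _).trans h1')
    simp only [abs_mul]; linarith
  induction n generalizing w w' f g with
  | zero => exact key _ _ _ _ hf hg
  | succ n ih =>
    refine ⟨key _ _ _ _ hf.1 hg.1, fun M h0 h1 p hp =>
      (hf.2.1 M h0 h1 p hp).mul (hg.2.1 M h0 h1 p hp), fun a => ?_⟩
    have e1 := (ih hf.down (hg.2.2 a)).weq (w' := fun M p => w M p * w' M p / rho p) hV
      (fun M h0 h1 p hp => by ring)
    have e2 := (ih hg.down (hf.2.2 a)).weq (w' := fun M p => w M p * w' M p / rho p) hV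
      (fun M h0 h1 p hp => by ring)
    refine (e1.add hV e2).congr hV fun M h0 h1 p hp => ?_
    simp only [pd]
    rw [fderiv_fun_mul (hf.2.1 M h0 h1 p hp) (hg.2.1 M h0 h1 p hp)]; rfl

lemma SymN.neg {m V n w f} (hV : Good V) (hf : SymN m V n w f) :
    SymN m V n w (fun M p => - f M p) :=
  (((SymN.const (-1)).mul hV hf).weq hV (fun _ _ _ _ _ => one_mul _)).congr hV
    (fun _ _ _ _ _ => by ring)

lemma SymN.sub {m V n w f g} (hV : Good V) (hf : SymN m V n w f) (hg : SymN m V n w g) :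
    SymN m V n w (fun M p => f M p - g M p) :=
  (hf.add hV (hg.neg hV)).congr hV (fun _ _ _ _ _ => by ring)

lemma SymN.sum {m V n w} {ι : Type*} (hV : Good V) (s : Finset ι) {f : ι → ℝ → Spt → ℝ}
    (hf : ∀ i, SymN m V n w (f i)) : SymN m V n w (fun M p => ∑ i ∈ s, f i M p) := by
  classical
  induction s using Finset.induction_on with
  | empty => simpa using SymN.zero
  | insert i s hi ih =>
    simp only [Finset.sum_insert hi]
    exact (hf i).add hV ih

lemma SymN.prod1 {m V n} {ι : Type*} (hV : Good V) (s : Finset ι) {f : ι → ℝ → Spt → ℝ}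
    (hf : ∀ i, SymN m V n (fun _ _ => 1) (f i)) :
    SymN m V n (fun _ _ => 1) (fun M p => ∏ i ∈ s, f i M p) := by
  classical
  induction s using Finset.induction_on with
  | empty => simpa using SymN.const 1
  | insert i s hi ih =>
    simp only [Finset.prod_insert hi]
    exact ((hf i).mul hV ih).weq hV (by simp)

lemma SymN.inv {m V n w f} (hV : Good V) (hf : SymN m V n w f)
    (c : ℝ) (hc : 0 < c) (hw : ∀ M, 0 < M → M ≤ m → ∀ p ∈ V, 0 < w M p ∧ c * w M p ≤ f M p) :
    SymN m V n (fun M p => (w M p)⁻¹) (fun M p => (f M p)⁻¹) := by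
  have key : Bd m V (fun M p => (w M p)⁻¹) (fun M p => (f M p)⁻¹) := by
    refine ⟨c⁻¹, by positivity, fun M h0 h1 p hp => ?_⟩
    obtain ⟨h2, h3⟩ := hw M h0 h1 p hp
    have h4 : 0 < c * w M p := by positivity
    simp only
    rw [abs_of_pos (inv_pos.2 (h4.trans_le h3)), ← mul_inv]
    exact inv_anti₀ h4 h3
  induction n with
  | zero => exact key
  | succ n ih =>
    have hne : ∀ M, 0 < M → M ≤ m → ∀ p ∈ V, f M p ≠ 0 := fun M h0 h1 p hp => by
      obtain ⟨h2, h3⟩ := hw M h0 h1 p hp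
      have h4 : 0 < c * w M p := by positivity
      exact (h4.trans_le h3).ne'
    refine ⟨key, fun M h0 h1 p hp =>
      (hf.2.1 M h0 h1 p hp).inv (hne M h0 h1 p hp), fun a => ?_⟩
    have h := ih hf.down
    have h2 := (((h.mul hV h).mul hV (hf.2.2 a)).neg hV).weq
      (w' := fun M p => (w M p)⁻¹ / rho p) hV (fun M h0 h1 p hp => by
        have := (hw M h0 h1 p hp).1
        have := hV.pos p hp
        field_simp)
    refine h2.congr hV fun M h0 h1 p hp => ?_
    simp only [pd]
    have := ((hasDerivAt_inv (hne M h0 h1 p hp)).comp_hasFDerivAt p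
      (hf.2.1 M h0 h1 p hp).hasFDerivAt).fderiv
    have e : (fun p => (f M p)⁻¹) = (fun y => y⁻¹) ∘ (f M) := rfl
    rw [e, this]
    simp [pow_two, mul_comm]

lemma SymN.comp {m V n s} (hV : Good V) (hs : SymN m V n (fun _ _ => 1) s)
    (φ : ℝ → ℝ) (hφ : ContDiff ℝ (⊤:ℕ∞) φ) :
    SymN m V n (fun _ _ => 1) (fun M p => φ (s M p)) := by
  have key : ∀ φ : ℝ → ℝ, ContDiff ℝ (⊤:ℕ∞) φ → Bd m V (fun _ _ => 1) (fun M p => φ (s M p)) := by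
    intro φ hφ
    obtain ⟨R, hR, h⟩ := hs.bd
    obtain ⟨C, hC⟩ := (isCompact_Icc (a := -R) (b := R)).exists_bound_of_continuousOn
      hφ.continuous.continuousOn
    refine ⟨|C|, abs_nonneg _, fun M h0 h1 p hp => ?_⟩
    have h2 := h M h0 h1 p hp
    rw [mul_one] at h2
    have := hC (s M p) (abs_le.1 h2)
    rw [Real.norm_eq_abs] at this
    simp only [mul_one]
    exact this.trans (le_abs_self _)
  induction n generalizing φ with
  | zero => exact key φ hφ
  | succ n ih =>
    have hd : Differentiable ℝ φ := hφ.differentiable (by simp)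
    refine ⟨key φ hφ, fun M h0 h1 p hp => (hd _).fun_comp' p (hs.2.1 M h0 h1 p hp), fun a => ?_⟩
    have hφ' : ContDiff ℝ (⊤:ℕ∞) (deriv φ) := by
      have : ContDiff ℝ ((⊤:ℕ∞) + 1 : WithTop ℕ∞) φ := by simpa using hφ
      exact (contDiff_succ_iff_deriv.1 this).2.2
    have := ((ih hs.down (deriv φ) hφ' ).mul hV (hs.2.2 a)).weq
      (w' := fun M p => 1 / rho p) hV (fun M h0 h1 p hp => by ring)
    refine this.congr hV fun M h0 h1 p hp => ?_
    simp only [pd]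
    have := ((hd (s M p)).hasDerivAt.comp_hasFDerivAt p (hs.2.1 M h0 h1 p hp).hasFDerivAt).fderiv
    have e : (fun p => φ (s M p)) = φ ∘ (s M) := rfl
    rw [e, this]
    simp

lemma SymN.union {m V V0 V1 n} {w f : ℝ → Spt → ℝ} (hw : ∀ M, 0 < M → M ≤ m → ∀ p ∈ V, 0 ≤ w M p)
    (hV : Good V) (hs : V ⊆ V0 ∪ V1)
    (h0 : SymN m V0 n w f) (h1 : SymN m V1 n w f) : SymN m V n w f := by
  have key : ∀ w f, (∀ M, 0 < M → M ≤ m → ∀ p ∈ V, 0 ≤ w M p) →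
      Bd m V0 w f → Bd m V1 w f → Bd m V w f := by
    rintro w f hw ⟨C, hC, h⟩ ⟨D, hD, k⟩
    refine ⟨C + D, by positivity, fun M h0 h1 p hp => ?_⟩
    have := hw M h0 h1 p hp
    have := mul_nonneg hC this
    have := mul_nonneg hD (hw M h0 h1 p hp)
    rcases hs hp with h' | h'
    · have := h M h0 h1 p h'
      linarith
    · have := k M h0 h1 p h'
      linarith
  induction n generalizing w f with
  | zero => exact key _ _ hw h0 h1
  | succ n ih =>
    refine ⟨key _ _ hw h0.1 h1.1, fun M h2 h3 p hp => ?_, fun a => ih ?_ (h0.2.2 a) (h1.2.2 a)⟩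
    · rcases hs hp with h' | h'
      · exact h0.2.1 M h2 h3 p h'
      · exact h1.2.1 M h2 h3 p h'
    · intro M h2 h3 p hp
      exact div_nonneg (hw M h2 h3 p hp) (hV.pos p hp).le

lemma SymN.det {m V n} (hV : Good V) {B : ℝ → Spt → Matrix (Fin 4) (Fin 4) ℝ}
    (hB : ∀ i j, SymN m V n (fun _ _ => 1) (fun M p => B M p i j)) :
    SymN m V n (fun _ _ => 1) (fun M p => (B M p).det) := by
  simp only [Matrix.det_apply']
  refine SymN.sum hV _ fun σ => ?_
  exact ((SymN.const _).mul hV (SymN.prod1 hV _ fun i => hB (σ i) i)).weq hV (by simp)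

lemma SymN.minv {m V n} (hV : Good V) {B : ℝ → Spt → Matrix (Fin 4) (Fin 4) ℝ}
    (hB : ∀ i j, SymN m V n (fun _ _ => 1) (fun M p => B M p i j))
    (hd : ∀ M, 0 < M → M ≤ m → ∀ p ∈ V, 1/2 ≤ (B M p).det) (i j : Fin 4) :
    SymN m V n (fun _ _ => 1) (fun M p => (B M p)⁻¹ i j) := by
  have h1 : SymN m V n (fun _ _ => 1) (fun M p => ((B M p).det)⁻¹) :=
    ((SymN.det hV hB).inv hV (1/2) (by norm_num) (fun M h0 h1 p hp =>
      ⟨one_pos, by simpa using hd M h0 h1 p hp⟩)).weq hV (by simp)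
  have h2 : SymN m V n (fun _ _ => 1) (fun M p => (B M p).adjugate i j) := by
    simp only [Matrix.adjugate_apply]
    refine SymN.det hV fun k l => ?_
    simp only [Matrix.updateRow_apply]
    split_ifs
    · exact SymN.const _
    · exact hB k l
  refine ((h1.mul hV h2).weq hV (w' := fun _ _ => 1) (by simp)).congr hV fun M _ _ p _ => ?_
  simp [Matrix.inv_def]

def logw (p : Spt) : ℝ := Real.log (1 + ‖p.2‖) + 1

def VU : Set Spt := {p | -(1/2) < p.1 ∧ 0 < ‖p.2‖}
def VR : Set Spt := {p | -(1/2) < p.1 ∧ (1 + p.1)/8 < ‖p.2‖}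
def VZ : Set Spt := {p | -(1/2) < p.1 ∧ 0 < ‖p.2‖ ∧ ‖p.2‖ < (1 + p.1)/4}
def VA : Set Spt := {p | -(1/2) < p.1 ∧ (1 + p.1)/8 < ‖p.2‖ ∧ ‖p.2‖ < 1 + p.1}
def VB : Set Spt := {p | -(1/2) < p.1 ∧ 3*(1 + p.1)/4 < ‖p.2‖}

lemma rho_ge {p : Spt} (h : -(1/2) < p.1) : 1/2 + ‖p.2‖ < rho p := by
  unfold rho; linarith

lemma rho_pos' {p : Spt} (h : -(1/2) < p.1) : 0 < rho p := by
  have := rho_ge h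
  have := norm_nonneg p.2
  linarith

lemma goodVU : Good VU := by
  refine ⟨?_, fun p hp => rho_pos' hp.1⟩
  simp only [VU, Set.setOf_and]
  exact IsOpen.inter (isOpen_lt (by fun_prop) (by fun_prop))
    (isOpen_lt (by fun_prop) (by fun_prop))

lemma goodVR : Good VR := by
  refine ⟨?_, fun p hp => rho_pos' hp.1⟩
  simp only [VR, Set.setOf_and]
  exact IsOpen.inter (isOpen_lt (by fun_prop) (by fun_prop))
    (isOpen_lt (by fun_prop) (by fun_prop))

lemma goodVZ : Good VZ := by
  refine ⟨?_, fun p hp => rho_pos' hp.1⟩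
  simp only [VZ, Set.setOf_and]
  exact IsOpen.inter (isOpen_lt (by fun_prop) (by fun_prop)) (IsOpen.inter
    (isOpen_lt (by fun_prop) (by fun_prop)) (isOpen_lt (by fun_prop) (by fun_prop)))

lemma goodVA : Good VA := by
  refine ⟨?_, fun p hp => rho_pos' hp.1⟩
  simp only [VA, Set.setOf_and]
  exact IsOpen.inter (isOpen_lt (by fun_prop) (by fun_prop)) (IsOpen.inter
    (isOpen_lt (by fun_prop) (by fun_prop)) (isOpen_lt (by fun_prop) (by fun_prop)))

lemma goodVB : Good VB := by
  refine ⟨?_, fun p hp => rho_pos' hp.1⟩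
  simp only [VB, Set.setOf_and]
  exact IsOpen.inter (isOpen_lt (by fun_prop) (by fun_prop))
    (isOpen_lt (by fun_prop) (by fun_prop))

lemma logw_ge (p : Spt) : 1 ≤ logw p := by
  unfold logw
  have := Real.log_nonneg (x := 1 + ‖p.2‖) (by linarith [norm_nonneg p.2])
  linarith

lemma logw_le {p : Spt} (h : -(1/2) < p.1) : logw p ≤ 2 * rho p := by
  unfold logw
  have := Real.log_le_sub_one_of_pos (x := 1 + ‖p.2‖) (by linarith [norm_nonneg p.2])
  have := rho_ge h
  linarith [norm_nonneg p.2]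

lemma pd_t (a : Fin 4) (p : Spt) : pd a (fun q => q.1) p = kron 0 a := by
  have : fderiv ℝ (fun q : Spt => q.1) p = ContinuousLinearMap.fst ℝ ℝ E3 := fderiv_fst
  unfold pd
  rw [this]
  refine Fin.cases ?_ (fun i => ?_) a
  · simp [dir, kron]
  · simp [dir, kron, (Fin.succ_ne_zero i).symm]

def coordL (i : Fin 3) : Spt →L[ℝ] ℝ :=
  (EuclideanSpace.proj i : E3 →L[ℝ] ℝ).comp (ContinuousLinearMap.snd ℝ ℝ E3)

lemma coord_hasFDerivAt (i : Fin 3) (p : Spt) : HasFDerivAt (fun q : Spt => q.2 i) (coordL i) p :=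
  (coordL i).hasFDerivAt

lemma pd_x (i : Fin 3) (a : Fin 4) (p : Spt) : pd a (fun q => q.2 i) p = kron i.succ a := by
  unfold pd
  rw [(coord_hasFDerivAt i p).fderiv]
  refine Fin.cases ?_ (fun j => ?_) a
  · simp [dir, kron, coordL]
  · simp [dir, kron, coordL, Pi.single_apply]

lemma xup_diff (a : Fin 4) (p : Spt) : DifferentiableAt ℝ (fun q => xup q a) p := by
  refine Fin.cases ?_ (fun i => ?_) a
  · simp only [xup, Fin.cases_zero]; exact differentiableAt_fst
  · simp only [xup, Fin.cases_succ]; exact (coord_hasFDerivAt i p).differentiableAt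

lemma pd_xup (b a : Fin 4) (p : Spt) : pd a (fun q => xup q b) p = kron b a := by
  refine Fin.cases ?_ (fun i => ?_) b
  · simp only [xup, Fin.cases_zero]; exact pd_t a p
  · simp only [xup, Fin.cases_succ]; exact pd_x i a p

lemma coord_le (p : Spt) (i : Fin 3) : |p.2 i| ≤ ‖p.2‖ := by
  simpa using PiLp.norm_apply_le p.2 i

lemma xup_le {p : Spt} (h : -(1/2) < p.1) (a : Fin 4) : |xup p a| ≤ rho p := by
  have := rho_ge h
  have := norm_nonneg p.2
  refine Fin.cases ?_ (fun i => ?_) a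
  · simp only [xup, Fin.cases_zero]
    rw [abs_le]
    unfold rho at *
    constructor <;> linarith
  · simp only [xup, Fin.cases_succ]
    linarith [coord_le p i]

lemma sym_xup {m V n} (hV : Good V) (ht : ∀ p ∈ V, -(1/2) < p.1) (a : Fin 4) :
    SymN m V n (fun _ p => rho p) (fun _ p => xup p a) := by
  have key : Bd m V (fun _ p => rho p) (fun _ p => xup p a) :=
    ⟨1, zero_le_one, fun M h0 h1 p hp => by simpa using xup_le (ht p hp) a⟩
  cases n with
  | zero => exact key
  | succ n =>
    refine ⟨key, fun M _ _ p _ => xup_diff a p, fun b => ?_⟩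
    refine ((SymN.const (kron a b)).weq hV (fun M _ _ p hp => ?_)).congr hV
      fun M _ _ p hp => pd_xup a b p
    rw [div_self (hV.pos p hp).ne']

lemma sym_x {m V n} (hV : Good V) (ht : ∀ p ∈ V, -(1/2) < p.1) (i : Fin 3) :
    SymN m V n (fun _ p => rho p) (fun _ p => p.2 i) := by
  simpa [xup] using sym_xup (m := m) (n := n) hV ht i.succ

lemma pd_r {p : Spt} (hp : 0 < ‖p.2‖) (a : Fin 4) :
    HasFDerivAt (fun q : Spt => ‖q.2‖) (fderiv ℝ (fun q : Spt => ‖q.2‖) p) p ∧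
    pd a (fun q => ‖q.2‖) p =
      Fin.cases (motive := fun _ => ℝ) 0 (fun i => p.2 i * ‖p.2‖⁻¹) a := by
  have hne : p.2 ≠ 0 := by simpa using hp
  have hd : HasFDerivAt (fun q : Spt => ‖q.2‖) (fderiv ℝ (fun q : Spt => ‖q.2‖) p) p :=
    (differentiableAt_snd.norm ℝ hne).hasFDerivAt
  refine ⟨hd, ?_⟩
  have h2 : HasFDerivAt (fun q : Spt => ‖q.2‖ ^ 2) _ p :=
    (hasFDerivAt_snd (p := p)).norm_sq
  have h3 := hd.pow 2
  have h4 := congrArg (fun L => L (dir a)) (h2.unique h3)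
  revert h4
  unfold pd
  refine Fin.cases ?_ (fun i => ?_) a
  · simp [dir, hne]
  · simp [dir, hne]
    intro h
    rw [real_inner_comm, EuclideanSpace.inner_single_left] at h
    simp at h
    field_simp
    linarith

lemma VR_facts {p : Spt} (hp : p ∈ VR) : 0 < ‖p.2‖ ∧ rho p ≤ 9 * ‖p.2‖ ∧ ‖p.2‖ ≤ rho p
    ∧ 1/16 < ‖p.2‖ := by
  obtain ⟨h1, h2⟩ := hp
  unfold rho
  refine ⟨?_, ?_, ?_, ?_⟩ <;> linarith

lemma sym_r {m n} : SymN m VR n (fun _ p => rho p) (fun _ p => ‖p.2‖) := by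
  have key : Bd m VR (fun _ p => rho p) (fun _ p => ‖p.2‖) :=
    ⟨1, zero_le_one, fun M h0 h1 p hp => by simpa using (VR_facts hp).2.2.1⟩
  induction n with
  | zero => exact key
  | succ n ih =>
    refine ⟨key, fun M _ _ p hp => (pd_r (VR_facts hp).1 0).1.differentiableAt, fun a => ?_⟩
    have hu : SymN m VR n (fun _ p => (rho p)⁻¹) (fun _ p => ‖p.2‖⁻¹) :=
      ih.inv goodVR (1/9) (by norm_num) fun M _ _ p hp => by
        have := VR_facts hp
        exact ⟨goodVR.pos p hp, by linarith⟩
    have e : SymN m VR n (fun _ p => rho p / rho p) (fun M p =>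
        Fin.cases (motive := fun _ => ℝ) 0 (fun i => p.2 i * ‖p.2‖⁻¹) a) := by
      refine Fin.cases ?_ (fun i => ?_) a
      · simpa using SymN.zero
      · simpa [div_eq_mul_inv] using (sym_x goodVR (fun p hp => hp.1) i).mul goodVR hu
    exact e.congr goodVR fun M _ _ p hp => (pd_r (VR_facts hp).1 a).2

lemma sym_u {m n} : SymN m VR n (fun _ p => (rho p)⁻¹) (fun _ p => ‖p.2‖⁻¹) :=
  sym_r.inv goodVR (1/9) (by norm_num) fun M _ _ p hp => by
    have := VR_facts hp
    exact ⟨goodVR.pos p hp, by linarith⟩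

lemma sym_log {m n} : SymN m VR n (fun _ p => logw p) (fun _ p => Real.log ‖p.2‖) := by
  have key : Bd m VR (fun _ p => logw p) (fun _ p => Real.log ‖p.2‖) := by
    refine ⟨16, by norm_num, fun M h0 h1 p hp => ?_⟩
    have hf := VR_facts hp
    have h3 := Real.log_le_sub_one_of_pos (x := ‖p.2‖⁻¹) (inv_pos.2 hf.1)
    rw [Real.log_inv] at h3
    have h4 : ‖p.2‖⁻¹ ≤ 16 := by
      rw [inv_le_comm₀ hf.1 (by norm_num)]; linarith [hf.2.2.2]
    have h5 : Real.log ‖p.2‖ ≤ Real.log (1 + ‖p.2‖) := Real.log_le_log hf.1 (by linarith)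
    have h6 := logw_ge p
    rw [abs_le]
    constructor
    · linarith
    · unfold logw at *; linarith
  cases n with
  | zero => exact key
  | succ n =>
    refine ⟨key, fun M _ _ p hp =>
      (pd_r (VR_facts hp).1 0).1.differentiableAt.log (VR_facts hp).1.ne', fun a => ?_⟩
    have hr : SymN m VR (n+1) (fun _ p => rho p) (fun _ p => ‖p.2‖) := sym_r
    have := ((hr.2.2 a).mul goodVR sym_u).mono (w' := fun _ p => logw p / rho p) goodVR 1
      zero_le_one (fun M _ _ p hp => by
        have := goodVR.pos p hp
        have := logw_ge p
        rw [div_self (by positivity), one_mul, one_mul, inv_eq_one_div]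
        gcongr)
    refine this.congr goodVR fun M _ _ p hp => ?_
    simp only [pd]
    rw [((pd_r (VR_facts hp).1 0).1.log (VR_facts hp).1.ne').fderiv]
    simp [mul_comm]

lemma VA_sub : VA ⊆ VR := fun _ hp => ⟨hp.1, hp.2.1⟩
lemma VB_sub : VB ⊆ VR := fun p hp => ⟨hp.1, by have h1 := hp.1; have h2 := hp.2; linarith⟩

lemma sym_chi {m n} (χ : ℝ → ℝ) (hχ : ContDiff ℝ (⊤:ℕ∞) χ) :
    SymN m VA n (fun _ _ => 1) (fun _ p => χ (‖p.2‖ / (p.1 + 1))) := by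
  refine SymN.comp (s := fun _ p => ‖p.2‖ / (p.1 + 1)) goodVA ?_ χ hχ
  have ht : SymN m VA n (fun _ p => rho p) (fun _ p => p.1) := by
    simpa [xup] using sym_xup (m := m) (n := n) goodVA (fun p hp => hp.1) 0
  have h1 : SymN m VA n (fun _ p => rho p) (fun _ p => p.1 + 1) :=
    ht.add goodVA ((SymN.const 1).mono goodVA 2 (by norm_num) fun M _ _ p hp => by
      have := rho_ge hp.1
      linarith [norm_nonneg p.2])
  have h2 := h1.inv goodVA (1/2) (by norm_num) fun M _ _ p hp => by
    refine ⟨goodVA.pos p hp, ?_⟩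
    have := hp.2.2
    unfold rho
    linarith
  refine (((sym_r.restrict le_rfl VA_sub).mul goodVA h2).weq goodVA ?_).congr goodVA ?_
  · intro M _ _ p hp
    exact mul_inv_cancel₀ (goodVA.pos p hp).ne'
  · intro M _ _ p hp
    exact div_eq_mul_inv _ _

lemma sym_h {n} (χ : ℝ → ℝ) (hχ : ContDiff ℝ (⊤:ℕ∞) χ)
    (hχ0 : ∀ s ≤ (1:ℝ)/4, χ s = 0) (hχ1 : ∀ s, (3:ℝ)/4 ≤ s → χ s = 1) (a : Fin 4) :
    SymN 1 VU n (fun M p => M * logw p) (fun M p => xt M χ a p - xup p a) := by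
  refine Fin.cases ?_ (fun i => ?_) a
  · simpa [xt, xup] using SymN.zero
  simp only [xt, xup, Fin.cases_succ, add_sub_cancel_left]
  have hM : ∀ V, SymN 1 V n (fun M _ => M) (fun M _ => M) := fun V =>
    SymN.constM (fun M => M) ⟨1, zero_le_one, fun M h0 h1 p hp => by
      rw [abs_of_pos h0, one_mul]⟩
  have hom : SymN 1 VR n (fun _ _ => 1) (fun _ p => p.2 i / ‖p.2‖) :=
    (((sym_x goodVR (fun p hp => hp.1) i).mul goodVR sym_u).weq goodVR (fun M _ _ p hp =>
      mul_inv_cancel₀ (goodVR.pos p hp).ne')).congr goodVR fun M _ _ p hp => div_eq_mul_inv _ _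
  have hMo := (hM VR).mul goodVR hom
  have hA : SymN 1 VA n (fun M p => M * logw p) (fun M p =>
      M * (p.2 i / ‖p.2‖) * χ (‖p.2‖ / (p.1 + 1)) * Real.log ‖p.2‖) :=
    (((hMo.restrict le_rfl VA_sub).mul goodVA (sym_chi χ hχ)).mul goodVA
      (sym_log.restrict le_rfl VA_sub)).weq goodVA (by simp)
  have hB : SymN 1 VB n (fun M p => M * logw p) (fun M p =>
      M * (p.2 i / ‖p.2‖) * χ (‖p.2‖ / (p.1 + 1)) * Real.log ‖p.2‖) := by
    refine (((hMo.mul goodVR sym_log).restrict le_rfl VB_sub).weq goodVB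
      (by simp)).congr goodVB fun M _ _ p hp => ?_
    have h1 := hp.1
    have h2 := hp.2
    rw [hχ1, mul_one]
    rw [le_div_iff₀ (by linarith)]
    linarith
  have hZ : SymN 1 VZ n (fun M p => M * logw p) (fun M p =>
      M * (p.2 i / ‖p.2‖) * χ (‖p.2‖ / (p.1 + 1)) * Real.log ‖p.2‖) := by
    refine SymN.zero.congr goodVZ fun M _ _ p hp => ?_
    have h1 := hp.1
    have h2 := hp.2.2
    rw [hχ0, mul_zero, zero_mul]
    rw [div_le_iff₀ (by linarith)]
    linarith
  have hw : ∀ V : Set Spt, ∀ M, 0 < M → M ≤ (1:ℝ) → ∀ p ∈ V, 0 ≤ M * logw p :=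
    fun V M h0 _ p _ => mul_nonneg h0.le (by linarith [logw_ge p])
  refine SymN.union (V0 := VZ) (V1 := VR) (hw _) goodVU ?_ hZ
    (SymN.union (V0 := VA) (V1 := VB) (hw _) goodVR ?_ hA hB)
  · intro p hp
    by_cases h : ‖p.2‖ < (1 + p.1)/4
    · exact Or.inl ⟨hp.1, hp.2, h⟩
    · have h1 := hp.1
      exact Or.inr ⟨hp.1, by linarith⟩
  · intro p hp
    by_cases h : ‖p.2‖ < 1 + p.1
    · exact Or.inl ⟨hp.1, hp.2, h⟩
    · have h1 := hp.1
      exact Or.inr ⟨hp.1, by linarith⟩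

lemma Bd.fin {m V w} {ι : Type*} [Fintype ι] {f : ι → ℝ → Spt → ℝ}
    (hw : ∀ M, 0 < M → M ≤ m → ∀ p ∈ V, 0 ≤ w M p)
    (h : ∀ i, Bd m V w (f i)) :
    ∃ C, 0 ≤ C ∧ ∀ i, ∀ M, 0 < M → M ≤ m → ∀ p ∈ V, |f i M p| ≤ C * w M p := by
  choose C hC h using h
  refine ⟨∑ i, C i, Finset.sum_nonneg fun i _ => hC i, fun i M h0 h1 p hp => ?_⟩
  refine (h i M h0 h1 p hp).trans ?_
  gcongr
  · exact hw M h0 h1 p hp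
  · exact Finset.single_le_sum (f := C) (fun i _ => hC i) (Finset.mem_univ i)

lemma det_near_one : ∃ δ > 0, ∀ B : Matrix (Fin 4) (Fin 4) ℝ,
    (∀ i j, |B i j - (1 : Matrix (Fin 4) (Fin 4) ℝ) i j| ≤ δ) → 1/2 ≤ B.det := by
  have hc : Continuous fun B : Fin 4 → Fin 4 → ℝ => (Matrix.of B).det :=
    Continuous.matrix_det (by exact continuous_id)
  have h := Metric.continuousAt_iff.1
    (hc.continuousAt (x := fun i j => (1 : Matrix (Fin 4) (Fin 4) ℝ) i j)) (1/2) (by norm_num)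
  obtain ⟨δ, hδ, h⟩ := h
  refine ⟨δ/2, by positivity, fun B hB => ?_⟩
  have h2 : dist (fun i j => B i j) (fun i j => (1 : Matrix (Fin 4) (Fin 4) ℝ) i j) < δ := by
    refine lt_of_le_of_lt ?_ (half_lt_self hδ)
    rw [dist_pi_le_iff (by positivity)]
    intro i
    rw [dist_pi_le_iff (by positivity)]
    intro j
    exact hB i j
  have h3 := h h2
  have e : (Matrix.of fun i j => (1 : Matrix (Fin 4) (Fin 4) ℝ) i j).det = 1 := Matrix.det_one
  have e2 : (Matrix.of fun i j => B i j) = B := rfl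
  rw [e, e2, Real.dist_eq] at h3
  have := (abs_lt.1 h3).1
  linarith

lemma sym_E {n} (χ : ℝ → ℝ) (hχ : ContDiff ℝ (⊤:ℕ∞) χ)
    (hχ0 : ∀ s ≤ (1:ℝ)/4, χ s = 0) (hχ1 : ∀ s, (3:ℝ)/4 ≤ s → χ s = 1) (a α : Fin 4) :
    SymN 1 VU n (fun M p => M * logw p / rho p) (fun M p => Amat M χ p a α - kron a α) := by
  have h := sym_h (n := n+1) χ hχ hχ0 hχ1 a
  refine (h.2.2 α).congr goodVU fun M h0 h1 p hp => ?_
  have hd := h.2.1 M h0 h1 p hp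
  have hx : DifferentiableAt ℝ (xt M χ a) p := by
    simpa using hd.fun_add (xup_diff a p)
  rw [Amat, Matrix.of_apply, ← pd_xup a α p]
  simp only [pd]
  rw [fderiv_fun_sub hx (xup_diff a p)]; rfl

lemma ML_le {M : ℝ} (h0 : 0 < M) (h1 : M ≤ 1) {p : Spt} (hp : p ∈ VU) :
    M * logw p / rho p ≤ 2 * M := by
  have h := logw_le hp.1
  rw [div_le_iff₀ (goodVU.pos p hp)]
  nlinarith

/-- All symbol facts on the Jacobian. -/
structure Jac (χ : ℝ → ℝ) (m : ℝ) : Prop where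
  m1 : m ≤ 1
  hE : ∀ n a α, SymN m VU n (fun M p => M * logw p / rho p) (fun M p => Amat M χ p a α - kron a α)
  hdet : ∀ M, 0 < M → M ≤ m → ∀ p ∈ VU, 1/2 ≤ (Amat M χ p).det
  hX : ∀ n a, SymN m VU n (fun _ p => rho p) (fun M p => xt M χ a p)

lemma exists_jac (χ : ℝ → ℝ) (hχ : ContDiff ℝ (⊤:ℕ∞) χ)
    (hχ0 : ∀ s ≤ (1:ℝ)/4, χ s = 0) (hχ1 : ∀ s, (3:ℝ)/4 ≤ s → χ s = 1) :
    ∃ m, 0 < m ∧ Jac χ m := by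
  obtain ⟨δ, hδ, hdet⟩ := det_near_one
  obtain ⟨C, hC, hb⟩ := Bd.fin (m := 1) (V := VU) (w := fun M p => M * logw p / rho p)
    (f := fun (x : Fin 4 × Fin 4) M p => Amat M χ p x.1 x.2 - kron x.1 x.2)
    (fun M h0 h1 p hp => by
      have := goodVU.pos p hp
      have := logw_ge p
      positivity)
    (fun x => (sym_E (n := 0) χ hχ hχ0 hχ1 x.1 x.2).bd)
  refine ⟨min 1 (δ / (2 * (C + 1))), by positivity, min_le_left _ _, fun n a α =>
    (sym_E χ hχ hχ0 hχ1 a α).restrict (min_le_left _ _) subset_rfl, ?_, fun n a => ?_⟩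
  · intro M h0 h1 p hp
    have h2 := h1.trans (min_le_left _ _)
    have h3 := h1.trans (min_le_right _ _)
    refine hdet _ fun i j => ?_
    have h4 := hb (i, j) M h0 h2 p hp
    have h5 := ML_le h0 h2 hp
    simp only [kron] at h4
    rw [Matrix.one_apply]
    refine h4.trans ?_
    rw [le_div_iff₀ (by positivity)] at h3
    have := mul_le_mul_of_nonneg_left h5 hC
    nlinarith
  · have h := (sym_h (n := n) χ hχ hχ0 hχ1 a).restrict (min_le_left _ (δ / (2 * (C + 1))))
      (subset_refl VU)
    have h2 := h.mono (w' := fun _ p => rho p) goodVU 2 (by norm_num) fun M h0 h1 p hp => by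
      have := logw_le hp.1
      have := h1.trans (min_le_left _ _)
      have := logw_ge p
      nlinarith
    exact (h2.add goodVU (sym_xup goodVU (fun p hp => hp.1) a)).congr goodVU
      fun M _ _ p _ => by ring

section
variable {χ : ℝ → ℝ} {m : ℝ} (J : Jac χ m)
include J

lemma Jac.hE1 (n a α) : SymN m VU n (fun _ _ => 1) (fun M p => Amat M χ p a α - kron a α) :=
  (J.hE n a α).mono goodVU 2 (by norm_num) fun M h0 h1 p hp => by
    have := ML_le h0 (h1.trans J.m1) hp
    have := J.m1
    linarith

lemma Jac.hA (n a α) : SymN m VU n (fun _ _ => 1) (fun M p => Amat M χ p a α) :=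
  ((J.hE1 n a α).add goodVU (SymN.const (kron a α))).congr goodVU fun M _ _ p _ => by ring

lemma Jac.hAi (n α a) : SymN m VU n (fun _ _ => 1) (fun M p => Ainv M χ p α a) :=
  SymN.minv goodVU (J.hA n) J.hdet α a

lemma Jac.hF (n α a) : SymN m VU n (fun M p => M * logw p / rho p)
    (fun M p => Ainv M χ p α a - kron α a) := by
  have h : SymN m VU n (fun M p => M * logw p / rho p)
      (fun M p => ∑ β, Ainv M χ p α β * (Amat M χ p β a - kron β a)) :=
    SymN.sum goodVU _ fun β => ((J.hAi n α β).mul goodVU (J.hE n β a)).weq goodVU (by simp)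
  refine (h.neg goodVU).congr goodVU fun M h0 h1 p hp => ?_
  have hd := J.hdet M h0 h1 p hp
  have e : Ainv M χ p * Amat M χ p = 1 :=
    Matrix.nonsing_inv_mul _ (isUnit_iff_ne_zero.2 (by linarith))
  have e2 := congrFun (congrFun e α) a
  rw [Matrix.mul_apply, Matrix.one_apply] at e2
  simp only [mul_sub, Finset.sum_sub_distrib, e2]
  simp [kron]

lemma Jac.tpd {n w} {f : ℝ → Spt → ℝ} (hf : SymN m VU (n+1) w f) (c : Fin 4) :
    SymN m VU n (fun M p => w M p / rho p) (fun M p => tpd M χ c (f M) p) := by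
  have h : SymN m VU n (fun M p => w M p / rho p)
      (fun M p => ∑ α, Ainv M χ p α c * pd α (f M) p) :=
    SymN.sum goodVU _ fun α => ((J.hAi n α c).mul goodVU (hf.2.2 α)).weq goodVU (by simp)
  refine h.congr goodVU fun M _ _ p _ => ?_
  simp [_root_.tpd, tdirVec, toVec, pd, map_sum]

lemma sum_kron_eta (a b : Fin 4) :
    ∑ α : Fin 4, ∑ β : Fin 4, kron a α * kron b β * eta α β = eta a b := by
  simp [kron]

lemma Jac.quad {n} {F : ℝ → Spt → Fin 4 → Fin 4 → ℝ}
    (hF : ∀ a α, SymN m VU n (fun M p => M * logw p / rho p) (fun M p => F M p a α - kron a α))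
    (hF1 : ∀ a α, SymN m VU n (fun _ _ => 1) (fun M p => F M p a α)) (a b : Fin 4) :
    SymN m VU n (fun M p => M * logw p / rho p)
      (fun M p => ∑ α : Fin 4, ∑ β : Fin 4, F M p a α * F M p b β * eta α β - eta a b) := by
  have h : SymN m VU n (fun M p => M * logw p / rho p)
      (fun M p => ∑ α : Fin 4, ∑ β : Fin 4, ((F M p a α - kron a α) * F M p b β
        + kron a α * (F M p b β - kron b β)) * eta α β) := by
    refine SymN.sum goodVU _ fun α => SymN.sum goodVU _ fun β => ?_
    refine SymN.weq goodVU (SymN.mul (w' := fun _ _ => 1) goodVU (SymN.add goodVU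
      (w := fun M p => M * logw p / rho p) ?_ ?_) (SymN.const _)) (by simp)
    · exact ((hF a α).mul goodVU (hF1 b β)).weq goodVU (by simp)
    · exact ((SymN.const (kron a α)).mul goodVU (hF b β)).weq goodVU (by simp)
  refine h.congr goodVU fun M _ _ p _ => ?_
  rw [← sum_kron_eta J a b, ← Finset.sum_sub_distrib]
  refine Finset.sum_congr rfl fun α _ => ?_
  rw [← Finset.sum_sub_distrib]
  refine Finset.sum_congr rfl fun β _ => ?_
  ring

lemma Jac.hUp (n a b) : SymN m VU n (fun M p => M * logw p / rho p)
    (fun M p => mtUp M χ p a b - eta a b) :=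
  J.quad (F := fun M p => Amat M χ p) (J.hE n) (J.hA n) a b

lemma kron_comm' (a b : Fin 4) : kron a b = kron b a := by simp [kron, eq_comm]

lemma Jac.hLow (n a b) : SymN m VU n (fun M p => M * logw p / rho p)
    (fun M p => mtLow M χ p a b - eta a b) := by
  refine (J.quad (F := fun M p a α => Ainv M χ p α a) (fun a α => ?_)
    (fun a α => J.hAi n α a) a b).congr goodVU fun M _ _ p _ => ?_
  · rw [kron_comm' J]; exact J.hF n α a
  · unfold mtLow
    congr 1
    refine Finset.sum_congr rfl fun α _ => Finset.sum_congr rfl fun β _ => ?_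
    ring

lemma Jac.htLow (n c a b) : SymN m VU n (fun M p => M * logw p / rho p / rho p)
    (fun M p => _root_.tpd M χ c (fun q => mtLow M χ q a b) p) := by
  refine (J.tpd (J.hLow (n+1) a b) c).congr goodVU fun M _ _ p _ => ?_
  simp only [_root_.tpd]
  rw [fderiv_sub_const]

lemma Jac.hUp1 (n a b) : SymN m VU n (fun _ _ => 1) (fun M p => mtUp M χ p a b) := by
  unfold mtUp
  refine SymN.sum goodVU _ fun α => SymN.sum goodVU _ fun β => ?_
  exact (((J.hA n a α).mul goodVU (J.hA n b β)).mul goodVU (SymN.const _)).weq goodVU (by simp)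

lemma Jac.hGam (n c a b) : SymN m VU n (fun M p => M * logw p / rho p / rho p)
    (fun M p => Gammahat M χ p c a b) := by
  unfold Gammahat
  refine SymN.weq goodVU ((SymN.const (1/2)).mul goodVU
    (w' := fun M p => M * logw p / rho p / rho p)
    (SymN.sum goodVU _ fun d => SymN.weq goodVU ((J.hUp1 n c d).mul goodVU
      (((J.htLow n a b d).add goodVU (J.htLow n b a d)).sub goodVU (J.htLow n d a b)))
      (by simp))) (by simp)

lemma Jac.hXc (n X c) : SymN m VU n (fun _ p => rho p) (fun M p => Xcomp M χ X p c) := by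
  have hlow : ∀ a, SymN m VU n (fun _ p => rho p) (fun M p => xtlow M χ p a) := by
    intro a
    refine Fin.cases ?_ (fun i => ?_) a
    · have := (J.hX n 0).neg goodVU
      simpa [xtlow, xt] using this
    · simpa [xtlow, xtilde] using J.hX n i.succ
  rcases X with a | ab | _
  · simp only [Xcomp]
    exact (SymN.const _).mono goodVU 2 (by norm_num) fun M _ _ p hp => by
      have := rho_ge hp.1
      linarith [norm_nonneg p.2]
  · simp only [Xcomp]
    exact (((hlow _).mul goodVU (SymN.const _)).sub goodVU
      ((hlow _).mul goodVU (SymN.const _))).weq goodVU (by simp)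
  · simpa only [Xcomp, xtilde] using J.hX n c

lemma Jac.htX (n X e c) : SymN m VU n (fun _ _ => 1)
    (fun M p => _root_.tpd M χ e (fun q => Xcomp M χ X q c) p) :=
  (J.tpd (J.hXc (n+1) X c) e).weq goodVU fun M _ _ p hp => div_self (goodVU.pos p hp).ne'

lemma Jac.hXd {n w} {f : ℝ → Spt → ℝ} (hf : SymN m VU (n+1) w f) (X e) : SymN m VU n w
    (fun M p => Xcomp M χ X p e * _root_.tpd M χ e (f M) p) :=
  ((J.hXc n X e).mul goodVU (J.tpd hf e)).weq goodVU fun M _ _ p hp =>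
    mul_div_cancel₀ _ (goodVU.pos p hp).ne'

lemma Jac.hlieUp {j : ℕ} (I : Fin j → ZIdx) {w} {K : ℝ → Spt → Fin 4 → Fin 4 → ℝ}
    (hK : ∀ n a b, SymN m VU n w (fun M p => K M p a b)) (n a b) :
    SymN m VU n w (fun M p => lieUpT M χ I (K M) p a b) := by
  induction j generalizing n a b with
  | zero => exact hK n a b
  | succ j ih =>
    have ih := ih (fun j => I j.succ)
    simp only [lieUpT, lieUp]
    refine ((SymN.sum goodVU _ fun c => J.hXd (ih (n+1) a b) (I 0) c).sub goodVU
      (SymN.sum goodVU _ fun c => ?_)).sub goodVU (SymN.sum goodVU _ fun c => ?_)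
    · exact ((J.htX n (I 0) c a).mul goodVU (ih n c b)).weq goodVU (by simp)
    · exact ((J.htX n (I 0) c b).mul goodVU (ih n a c)).weq goodVU (by simp)

lemma Jac.hlie12 {j : ℕ} (I : Fin j → ZIdx) {w} {K : ℝ → Spt → Fin 4 → Fin 4 → Fin 4 → ℝ}
    (hK : ∀ n c a b, SymN m VU n w (fun M p => K M p c a b)) (n c a b) :
    SymN m VU n w (fun M p => lie12T M χ I (K M) p c a b) := by
  induction j generalizing n c a b with
  | zero => exact hK n c a b
  | succ j ih =>
    have ih := ih (fun j => I j.succ)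
    simp only [lie12T, lie12]
    refine (((SymN.sum goodVU _ fun e => J.hXd (ih (n+1) c a b) (I 0) e).sub goodVU
      (SymN.sum goodVU _ fun e => ?_)).add goodVU (SymN.sum goodVU _ fun e => ?_)).add goodVU
      (SymN.sum goodVU _ fun e => ?_)
    · exact ((J.htX n (I 0) e c).mul goodVU (ih n e a b)).weq goodVU (by simp)
    · exact ((J.htX n (I 0) a e).mul goodVU (ih n c e b)).weq goodVU (by simp)
    · exact ((J.htX n (I 0) b e).mul goodVU (ih n c a e)).weq goodVU (by simp)

end

/-- **Lie-derivative bounds for the Christoffel symbols of `m̃` and for `m̃⁻¹ - m̂`**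
(estimates (est:tildeGamma) and (est:LieMtilde)):
`|ℒ_{X̃}^I Γ̂| ≤ C_I M (ln(1+r)+1)(1+r+t)⁻²` and
`|ℒ_{X̃}^I(m̃^{ab} - m̂^{ab})| ≤ C_I M (ln(1+r)+1)(1+r+t)⁻¹` for `t ≥ 0`, `x ≠ 0`. -/
theorem lie_bounds_Gammahat_mtilde
    (χ : ℝ → ℝ) (hχ : ContDiff ℝ (⊤:ℕ∞) χ)
    (hχ0 : ∀ s ≤ (1:ℝ)/4, χ s = 0) (hχ1 : ∀ s, (3:ℝ)/4 ≤ s → χ s = 1)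
    (hχb : ∀ s, 0 ≤ χ s ∧ χ s ≤ 1) :
    ∃ M₀ : ℝ, 0 < M₀ ∧
    ∀ (j : ℕ) (I : Fin j → ZIdx), ∃ C : ℝ, 0 < C ∧
      ∀ M : ℝ, 0 < M → M ≤ M₀ →
      ∀ p : Spt, 0 ≤ p.1 → p.2 ≠ 0 →
        (∀ c a b : Fin 4,
          |lie12T M χ I (fun q => Gammahat M χ q) p c a b|
            ≤ C * M * (Real.log (1 + ‖p.2‖) + 1) / (1 + ‖p.2‖ + p.1)^2) ∧
        (∀ a b : Fin 4,
          |lieUpT M χ I (fun q a b => mtUp M χ q a b - eta a b) p a b|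
            ≤ C * M * (Real.log (1 + ‖p.2‖) + 1) / (1 + ‖p.2‖ + p.1)) := by
  obtain ⟨m, hm, J⟩ := exists_jac χ hχ hχ0 hχ1
  refine ⟨m, hm, fun j I => ?_⟩
  have hw1 : ∀ M, 0 < M → M ≤ m → ∀ p ∈ VU, 0 ≤ M * logw p / rho p :=
    fun M h0 h1 p hp => by
      have := goodVU.pos p hp
      have := logw_ge p
      positivity
  have hw2 : ∀ M, 0 < M → M ≤ m → ∀ p ∈ VU, 0 ≤ M * logw p / rho p / rho p :=
    fun M h0 h1 p hp => div_nonneg (hw1 M h0 h1 p hp) (goodVU.pos p hp).le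
  obtain ⟨C, hC, h12⟩ := Bd.fin (V := VU)
    (f := fun (x : Fin 4 × Fin 4 × Fin 4) M p =>
      lie12T M χ I (fun q => Gammahat M χ q) p x.1 x.2.1 x.2.2) hw2
    (fun x => (J.hlie12 I (K := fun M q => Gammahat M χ q) J.hGam 0 x.1 x.2.1 x.2.2).bd)
  obtain ⟨D, hD, hup⟩ := Bd.fin (V := VU)
    (f := fun (x : Fin 4 × Fin 4) M p =>
      lieUpT M χ I (fun q a b => mtUp M χ q a b - eta a b) p x.1 x.2) hw1
    (fun x => (J.hlieUp I (K := fun M q a b => mtUp M χ q a b - eta a b) J.hUp 0 x.1 x.2).bd)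
  refine ⟨C + D + 1, by positivity, fun M h0 h1 p ht hp => ?_⟩
  have hpU : p ∈ VU := ⟨by linarith, by simpa using hp⟩
  have g1 := hw1 M h0 h1 p hpU
  have g2 := hw2 M h0 h1 p hpU
  refine ⟨fun c a b => (h12 (c, a, b) M h0 h1 p hpU).trans ?_,
    fun a b => (hup (a, b) M h0 h1 p hpU).trans ?_⟩
  · have e : (C + D + 1) * M * (Real.log (1 + ‖p.2‖) + 1) / (1 + ‖p.2‖ + p.1)^2
        = (C + D + 1) * (M * logw p / rho p / rho p) := by
      rw [div_div, ← pow_two]; unfold logw rho; ring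
    rw [e]
    exact mul_le_mul_of_nonneg_right (by linarith) g2
  · have e : (C + D + 1) * M * (Real.log (1 + ‖p.2‖) + 1) / (1 + ‖p.2‖ + p.1)
        = (C + D + 1) * (M * logw p / rho p) := by
      unfold logw rho; ring
    rw [e]
    exact mul_le_mul_of_nonneg_right (by linarith) g1
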